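/- Let (S, G) be a stabilizer subsystem code on N qubits, let e ⊆ Fin N be a set of erased sites, and let W = {(x, z) ∈ V : xᵢ = 0 and zᵢ = 0 for all i ∉ e} be the subspace of Pauli operators supported on e. If p is the uniform distribution on W (p(v) = 2^{−2|e|} for v ∈ W and p(v) = 0 otherwise), then the optimal recovery probability under this erasure error is P_R(S, G, p) = 2^{−r}, where r = dim(W ∩ C(S)) − dim(W ∩ G) is the number of independent errors supported on e that have trivial syndrome but nontrivial logical action. -/

import Mathlib

/-- The `F₂`-vector space of `N`-qubit Pauli operators modulo phase:
`v = (x, z)` represents `∏ᵢ Xᵢ^{xᵢ} Zᵢ^{zᵢ}`. -/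
abbrev PauliV (N : ℕ) := (Fin N → ZMod 2) × (Fin N → ZMod 2)

/-- The symplectic form `ω((x,z),(x',z')) = Σᵢ (xᵢ z'ᵢ + zᵢ x'ᵢ)`; it vanishes iff the
corresponding Pauli operators commute. -/
def omegaForm {N : ℕ} (v w : PauliV N) : ZMod 2 :=
  ∑ i, (v.1 i * w.2 i + v.2 i * w.1 i)

/-- The weight of a Pauli operator: the number of sites on which it acts nontrivially. -/
def pauliWeight {N : ℕ} (v : PauliV N) : ℕ :=
  (Finset.univ.filter fun i => v.1 i ≠ 0 ∨ v.2 i ≠ 0).card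

/-- The commutant `C(S) = {v : ω(v, s) = 0 for all s ∈ S}` of a subspace `S`. -/
def commutant {N : ℕ} (S : Submodule (ZMod 2) (PauliV N)) :
    Submodule (ZMod 2) (PauliV N) where
  carrier := {v | ∀ s ∈ S, omegaForm v s = 0}
  add_mem' := by
    intro a b ha hb s hs
    have h : omegaForm (a + b) s = omegaForm a s + omegaForm b s := by
      unfold omegaForm
      rw [← Finset.sum_add_distrib]
      refine Finset.sum_congr rfl fun i _ => ?_
      simp only [Prod.fst_add, Prod.snd_add, Pi.add_apply]
      ring
    simp only [Set.mem_setOf_eq] at *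
    rw [h, ha s hs, hb s hs, add_zero]
  zero_mem' := by
    intro s hs
    simp [omegaForm]
  smul_mem' := by
    intro c v hv s hs
    have h : omegaForm (c • v) s = c * omegaForm v s := by
      unfold omegaForm
      rw [Finset.mul_sum]
      refine Finset.sum_congr rfl fun i _ => ?_
      simp only [Prod.smul_fst, Prod.smul_snd, Pi.smul_apply, smul_eq_mul]
      ring
    simp only [Set.mem_setOf_eq] at *
    rw [h, hv s hs, mul_zero]

/-- The code distance of a stabilizer subsystem code `(S, G)`: the minimal weight of an
element of `C(S)` not in `G` (a bare logical operator). -/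
noncomputable def codeDistance {N : ℕ} (S G : Submodule (ZMod 2) (PauliV N)) : ℕ :=
  sInf {n | ∃ v, v ∈ commutant S ∧ v ∉ G ∧ pauliWeight v = n}

attribute [local instance] Classical.propDecidable

/-- The total probability `p(ℓ)` of the coset `ℓ = w + G` (a logical equivalence class). -/
noncomputable def cosetProb {N : ℕ} (G : Submodule (ZMod 2) (PauliV N))
    (p : PauliV N → ℝ) (w : PauliV N) : ℝ :=
  ∑ u : PauliV N, if u - w ∈ G then p u else 0

/-- The optimal (maximum-likelihood) recovery probability
`P_R(S, G, p) = Σ_c max_{ℓ ⊆ c} p(ℓ)`, where `c` ranges over the cosets of `C(S)` in `V`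
(syndrome classes) and `ℓ` over the cosets of `G` contained in `c` (logical classes). -/
noncomputable def recoveryProb {N : ℕ} (S G : Submodule (ZMod 2) (PauliV N))
    (p : PauliV N → ℝ) : ℝ :=
  ∑ᶠ c : PauliV N ⧸ commutant S,
    ⨆ w : {w : PauliV N // (Submodule.Quotient.mk w : PauliV N ⧸ commutant S) = c},
      cosetProb G p w.1

/-- The subspace `W` of Pauli operators supported on a set `e` of erased sites. -/
def erasedSupport {N : ℕ} (e : Finset (Fin N)) : Submodule (ZMod 2) (PauliV N) where
  carrier := {v | ∀ i, i ∉ e → v.1 i = 0 ∧ v.2 i = 0}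
  add_mem' := by
    intro a b ha hb i hi
    simp only [Set.mem_setOf_eq] at *
    simp [Prod.fst_add, Prod.snd_add, Pi.add_apply,
      (ha i hi).1, (ha i hi).2, (hb i hi).1, (hb i hi).2]
  zero_mem' := by intro i hi; simp
  smul_mem' := by
    intro c v hv i hi
    simp only [Set.mem_setOf_eq] at *
    simp [Prod.smul_fst, Prod.smul_snd, Pi.smul_apply, (hv i hi).1, (hv i hi).2]

/-- Restriction to the sites of `e` identifies the operators supported on `e` with pairs of
bit strings indexed by `e`. -/
def erasedSupportEquiv {N : ℕ} (e : Finset (Fin N)) :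
    erasedSupport e ≃ₗ[ZMod 2] (e → ZMod 2) × (e → ZMod 2) where
  toFun v := (fun i => v.1.1 i, fun i => v.1.2 i)
  map_add' _ _ := rfl
  map_smul' _ _ := rfl
  invFun f := ⟨(fun i => if h : i ∈ e then f.1 ⟨i, h⟩ else 0,
    fun i => if h : i ∈ e then f.2 ⟨i, h⟩ else 0), fun i hi => by simp [hi]⟩
  left_inv v := by
    ext i
    · by_cases h : i ∈ e
      · simp [h]
      · simp [h, (v.2 i h).1]
    · by_cases h : i ∈ e
      · simp [h]
      · simp [h, (v.2 i h).2]
  right_inv f := by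
    ext i <;> simp

lemma finrank_erasedSupport {N : ℕ} (e : Finset (Fin N)) :
    Module.finrank (ZMod 2) (erasedSupport e) = 2 * e.card := by
  rw [(erasedSupportEquiv e).finrank_eq]
  simp
  ring

lemma finrank_map_mkQ_add_finrank_inf {K V : Type*} [Field K] [AddCommGroup V] [Module K V]
    [FiniteDimensional K V] (W C : Submodule K V) :
    Module.finrank K (W.map C.mkQ) + Module.finrank K (W ⊓ C : Submodule K V) =
      Module.finrank K W := by
  rw [← LinearMap.finrank_range_add_finrank_ker (C.mkQ.domRestrict W), LinearMap.range_domRestrict,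
    LinearMap.ker_domRestrict, Submodule.ker_mkQ, ← Submodule.map_comap_subtype,
    Submodule.finrank_map_subtype_eq]

/-- A coset of `G` meeting `W` meets it in a translate of `W ⊓ G`. -/
lemma cosetProb_uniform_of_mem {N : ℕ} (W G : Submodule (ZMod 2) (PauliV N)) (q : ℝ)
    {u w : PauliV N} (hu : u ∈ W) (huw : u - w ∈ G) :
    cosetProb G (fun v => if v ∈ W then q else 0) w =
      2 ^ Module.finrank (ZMod 2) (W ⊓ G : Submodule (ZMod 2) (PauliV N)) * q := by
  have hcard : (Nat.card (W ⊓ G : Submodule (ZMod 2) (PauliV N)) : ℝ) =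
      2 ^ Module.finrank (ZMod 2) (W ⊓ G : Submodule (ZMod 2) (PauliV N)) := by
    rw [Module.natCard_eq_pow_finrank (K := ZMod 2)]
    simp
  unfold cosetProb
  rw [← Equiv.sum_comp (Equiv.addRight u), ← hcard]
  have hterm (v : PauliV N) :
      (if Equiv.addRight u v - w ∈ G then (if Equiv.addRight u v ∈ W then q else 0) else 0) =
        if v ∈ W ⊓ G then q else 0 := by
    have hG : v + u - w ∈ G ↔ v ∈ G := by
      rw [add_sub_assoc]
      exact G.add_mem_iff_left huw
    have hW : v + u ∈ W ↔ v ∈ W := W.add_mem_iff_left hu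
    simp only [Equiv.coe_addRight, hG, hW, Submodule.mem_inf]
    split_ifs <;> tauto
  rw [Finset.sum_congr rfl fun v _ => hterm v, ← Finset.sum_filter, Finset.sum_const,
    nsmul_eq_mul, ← Fintype.card_subtype, ← Nat.card_eq_fintype_card]

lemma cosetProb_uniform_of_forall_notMem {N : ℕ} (W G : Submodule (ZMod 2) (PauliV N)) (q : ℝ)
    {w : PauliV N} (h : ∀ u ∈ W, u - w ∉ G) :
    cosetProb G (fun v => if v ∈ W then q else 0) w = 0 :=
  Finset.sum_eq_zero fun u _ => by
    by_cases hu : u ∈ W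
    · simp [h u hu]
    · simp [hu]

/-- The most likely logical class has the weight of `W ⊓ G` if the syndrome is that of
an element of `W`, and weight zero otherwise. -/
lemma iSup_cosetProb_uniform {N : ℕ} (W G C : Submodule (ZMod 2) (PauliV N)) (hGC : G ≤ C)
    {q : ℝ} (hq : 0 ≤ q) (c : PauliV N ⧸ C) :
    (⨆ w : {w : PauliV N // (Submodule.Quotient.mk w : PauliV N ⧸ C) = c},
        cosetProb G (fun v => if v ∈ W then q else 0) w.1) =
      if c ∈ W.map C.mkQ then
        2 ^ Module.finrank (ZMod 2) (W ⊓ G : Submodule (ZMod 2) (PauliV N)) * q else 0 := by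
  obtain ⟨w₀, hw₀⟩ := Submodule.Quotient.mk_surjective C c
  have : Nonempty {w : PauliV N // (Submodule.Quotient.mk w : PauliV N ⧸ C) = c} :=
    ⟨⟨w₀, hw₀⟩⟩
  split_ifs with hc
  · obtain ⟨u, hu, huc⟩ := hc
    have hle (w : PauliV N) : cosetProb G (fun v => if v ∈ W then q else 0) w ≤
        2 ^ Module.finrank (ZMod 2) (W ⊓ G : Submodule (ZMod 2) (PauliV N)) * q := by
      by_cases h : ∃ u ∈ W, u - w ∈ G
      · obtain ⟨u, hu, huw⟩ := h
        exact (cosetProb_uniform_of_mem W G q hu huw).le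
      · rw [cosetProb_uniform_of_forall_notMem W G q fun u hu huw => h ⟨u, hu, huw⟩]
        positivity
    refine le_antisymm (ciSup_le fun w => hle w.1) ?_
    refine le_ciSup_of_le ⟨_, Set.forall_mem_range.2 fun w => hle w.1⟩ ⟨u, huc⟩ ?_
    exact (cosetProb_uniform_of_mem W G q hu (by simp)).ge
  · have hzero (w : {w : PauliV N // (Submodule.Quotient.mk w : PauliV N ⧸ C) = c}) :
        cosetProb G (fun v => if v ∈ W then q else 0) w.1 = 0 :=
      cosetProb_uniform_of_forall_notMem W G q fun u hu huw =>
        hc ⟨u, hu, ((Submodule.Quotient.eq C).2 (hGC huw)).trans w.2⟩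
    simp [hzero]

/-- for a stabilizer subsystem code `(S, G)`, a set `e` of erased sites with
associated subspace `W` of Pauli operators supported on `e`, and `p` the uniform
distribution on `W` (`p v = 2^{-2|e|}` on `W`, else `0`), the optimal recovery
probability under this erasure error is `P_R(S, G, p) = 2^{-r}` with
`r = dim(W ⊓ C(S)) - dim(W ⊓ G)`, the number of independent errors supported on `e`
with trivial syndrome but nontrivial logical action. -/
theorem erasure_recovery_probability (N : ℕ) (hN : 1 ≤ N)
    (S G : Submodule (ZMod 2) (PauliV N))
    (hSG : S ≤ G) (hGC : G ≤ commutant S)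
    (e : Finset (Fin N))
    (W : Submodule (ZMod 2) (PauliV N)) (hW : W = erasedSupport e)
    (p : PauliV N → ℝ)
    (hp : p = fun v => if v ∈ W then ((2 : ℝ) ^ (2 * e.card))⁻¹ else 0) :
    recoveryProb S G p =
      ((2 : ℝ) ^ (Module.finrank (ZMod 2)
          (W ⊓ commutant S : Submodule (ZMod 2) (PauliV N)) -
        Module.finrank (ZMod 2) (W ⊓ G : Submodule (ZMod 2) (PauliV N))))⁻¹ := by
  have hq : (0 : ℝ) ≤ ((2 : ℝ) ^ (2 * e.card))⁻¹ := by positivity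
  have hmap : (Nat.card (W.map (commutant S).mkQ) : ℝ) =
      2 ^ Module.finrank (ZMod 2) (W.map (commutant S).mkQ) := by
    rw [Module.natCard_eq_pow_finrank (K := ZMod 2)]
    simp
  have hdim := finrank_map_mkQ_add_finrank_inf W (commutant S)
  have hrank : Module.finrank (ZMod 2) W = 2 * e.card := hW ▸ finrank_erasedSupport e
  have hle : Module.finrank (ZMod 2) (W ⊓ G : Submodule (ZMod 2) (PauliV N)) ≤
      Module.finrank (ZMod 2) (W ⊓ commutant S : Submodule (ZMod 2) (PauliV N)) :=
    Submodule.finrank_mono (inf_le_inf_left W hGC)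
  have hfin : Fintype (PauliV N ⧸ commutant S) := Fintype.ofFinite _
  unfold recoveryProb
  rw [hp, finsum_eq_sum_of_fintype]
  simp only [iSup_cosetProb_uniform W G (commutant S) hGC hq]
  rw [← Finset.sum_filter, Finset.sum_const, nsmul_eq_mul, ← Fintype.card_subtype,
    ← Nat.card_eq_fintype_card]
  refine (congrArg (· * _) hmap).trans ?_
  obtain ⟨r, hr⟩ := Nat.exists_eq_add_of_le hle
  rw [← hrank, ← hdim, hr, Nat.add_sub_cancel_left, pow_add, pow_add]
  field_simp
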